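/- Let K be a field, L/K a finite Galois extension with L not formally real, and E a totally real extension of K contained in a finite Galois extension F of K (so every ordering of K extends to E). For each involution ε ∈ Gal(F/E) whose fixed field F(ε) is formally real, the set X_ε = {P ∈ X(K) : P extends to F(ε)} is clopen in the space of orderings X(K). -/

import Mathlib

/-- An ordering of the field `K`, given by its cone `P` of elements `≥ 0`:
closed under addition and multiplication, `P ∪ -P = K`, and `-1 ∉ P`. -/
def IsOrderingCone (K : Type*) [Field K] (P : Set K) : Prop :=
  (∀ x ∈ P, ∀ y ∈ P, x + y ∈ P) ∧ (∀ x ∈ P, ∀ y ∈ P, x * y ∈ P) ∧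
  (∀ x : K, x ∈ P ∨ -x ∈ P) ∧ (-1 : K) ∉ P

/-- A field is formally real if it admits an ordering. -/
def IsFormallyRealField (K : Type*) [Field K] : Prop :=
  ∃ P : Set K, IsOrderingCone K P

open IntermediateField

/-- The Harrison topology on the space of orderings `X(K)` of a field `K`, with subbase
the sets `H(c) = {P : c ∈ P}`, `c ∈ K^×`. -/
def harrisonTopology (K : Type*) [Field K] :
    TopologicalSpace {P : Set K // IsOrderingCone K P} :=
  TopologicalSpace.generateFrom
    {S | ∃ c : K, c ≠ 0 ∧ S = {P : {P : Set K // IsOrderingCone K P} | c ∈ P.1}}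

/-- The signature of a quadratic form over a linearly ordered field. -/
noncomputable def QuadraticForm.signature {K V : Type*} [Field K] [LinearOrder K]
    [AddCommGroup V] [Module K V] (Q : QuadraticForm K V) : ℤ :=
  (sigPos Q : ℤ) - sigNeg Q

namespace QuadraticForm

open _root_.QuadraticMap Module

variable {K : Type*} [Field K] [LinearOrder K]
variable {V V' : Type*} [AddCommGroup V] [Module K V] [AddCommGroup V'] [Module K V']

lemma signature_congr {Q : QuadraticForm K V} {Q' : QuadraticForm K V'}
    (h : Q.Equivalent Q') : Q.signature = Q'.signature := by
  rw [signature, signature, h.sigPos_eq, h.sigNeg_eq]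

lemma signature_neg (Q : QuadraticForm K V) : (-Q).signature = -Q.signature := by
  simp [signature]

variable [IsStrictOrderedRing K]

lemma signature_weightedSumSquares {ι : Type*} [Fintype ι] (w : ι → K) :
    signature (weightedSumSquares K w) = ∑ i, (SignType.sign (w i) : ℤ) := by
  classical
  have h : ∀ i, (SignType.sign (w i) : ℤ) =
      (if 0 < w i then 1 else 0) - (if w i < 0 then 1 else 0) := by
    intro i
    rcases lt_trichotomy (w i) 0 with h | h | h
    · simp [h, h.not_gt]
    · simp [h]
    · simp [h, h.not_gt]
  rw [signature, sigPos_weightedSumSquares, sigNeg_weightedSumSquares, Finset.sum_congr rfl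
    fun i _ ↦ h i, Finset.sum_sub_distrib, Finset.sum_boole, Finset.sum_boole]
  simp [Set.ncard_eq_toFinset_card']

lemma exists_equivalent_weightedSumSquares [FiniteDimensional K V] (Q : QuadraticForm K V) :
    ∃ w : Fin (finrank K V) → K, Q.Equivalent (weightedSumSquares K w) :=
  have : Invertible (2 : K) := invertibleOfNonzero two_ne_zero
  Q.equivalent_weightedSumSquares

lemma signature_smul [FiniteDimensional K V] (c : K) (Q : QuadraticForm K V) :
    (c • Q).signature = SignType.sign c * Q.signature := by
  obtain ⟨w, ⟨e⟩⟩ := exists_equivalent_weightedSumSquares Q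
  have h : (c • Q).Equivalent (weightedSumSquares K fun i ↦ c * w i) :=
    ⟨e.toLinearEquiv, fun x ↦ by
      have := e.map_app x
      simp only [weightedSumSquares_apply, smul_eq_mul, mul_assoc, ← Finset.mul_sum,
        smul_apply] at this ⊢
      rw [← this]; rfl⟩
  rw [signature_congr h, signature_congr ⟨e⟩, signature_weightedSumSquares,
    signature_weightedSumSquares, Finset.mul_sum]
  simp [sign_mul]

lemma signature_pi {I : Type*} [Fintype I] {V : I → Type*} [∀ i, AddCommGroup (V i)]
    [∀ i, Module K (V i)] [∀ i, FiniteDimensional K (V i)] (Q : ∀ i, QuadraticForm K (V i)) :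
    signature (QuadraticMap.pi Q) = ∑ i, (Q i).signature := by
  choose w hw using fun i ↦ exists_equivalent_weightedSumSquares (Q i)
  have h : (QuadraticMap.pi fun i ↦ weightedSumSquares K (w i)).Equivalent
      (weightedSumSquares K fun x : Σ i, Fin (finrank K (V i)) ↦ w x.1 x.2) :=
    ⟨(LinearEquiv.piCurry K fun i (_ : Fin (finrank K (V i))) ↦ K).symm, fun x ↦ by
      simp [weightedSumSquares_apply, Fintype.sum_sigma, LinearEquiv.piCurry, Sigma.uncurry]⟩
  rw [signature_congr (Equivalent.pi hw), signature_congr h, signature_weightedSumSquares,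
    Fintype.sum_sigma]
  exact Finset.sum_congr rfl fun i _ ↦ by
    rw [signature_congr (hw i), signature_weightedSumSquares]

end QuadraticForm

section TraceSignature

open Module QuadraticForm

/-- The trace form `x ↦ Tr(x ^ 2)` of an algebra, as a quadratic form. -/
noncomputable def traceQuadraticForm (K A : Type*) [Field K] [CommRing A] [Algebra K A] :
    QuadraticForm K A :=
  (Algebra.traceForm K A).toQuadraticMap

@[simp] lemma traceQuadraticForm_apply {K A : Type*} [Field K] [CommRing A] [Algebra K A] (x : A) :
    traceQuadraticForm K A x = Algebra.trace K A (x * x) := rfl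

lemma Algebra.trace_pi_apply {K I : Type*} [Field K] [Fintype I] {A : I → Type*}
    [∀ i, CommRing (A i)] [∀ i, Algebra K (A i)] [∀ i, FiniteDimensional K (A i)]
    (x : ∀ i, A i) :
    Algebra.trace K (∀ i, A i) x = ∑ i, Algebra.trace K (A i) (x i) := by
  classical
  let b := fun i ↦ finBasis K (A i)
  rw [Algebra.trace_eq_matrix_trace (Pi.basis b), Matrix.trace, Fintype.sum_sigma]
  refine Finset.sum_congr rfl fun i _ ↦ ?_
  rw [Algebra.trace_eq_matrix_trace (b i), Matrix.trace]
  refine Finset.sum_congr rfl fun j _ ↦ ?_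
  simp [Matrix.diag, Algebra.leftMulMatrix_eq_repr_mul, Pi.basis_repr, Pi.basis_apply]

variable {K : Type*} [Field K] [LinearOrder K]

lemma signature_traceQuadraticForm_congr {A B : Type*} [CommRing A] [Algebra K A] [CommRing B]
    [Algebra K B] (e : A ≃ₐ[K] B) :
    (traceQuadraticForm K A).signature = (traceQuadraticForm K B).signature :=
  signature_congr ⟨e.toLinearEquiv, fun x ↦ by
    simp [← map_mul, Algebra.trace_eq_of_algEquiv e]⟩

variable [IsStrictOrderedRing K]

lemma signature_traceQuadraticForm_pi {I : Type*} [Fintype I] {A : I → Type*}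
    [∀ i, CommRing (A i)] [∀ i, Algebra K (A i)] [∀ i, FiniteDimensional K (A i)] :
    (traceQuadraticForm K (∀ i, A i)).signature =
      ∑ i, (traceQuadraticForm K (A i)).signature := by
  rw [← signature_pi]
  congr 1
  ext x
  simp [Algebra.trace_pi_apply, QuadraticMap.pi_apply]

lemma signature_traceQuadraticForm_eq_sum {A ι : Type*} [CommRing A] [Algebra K A] [Fintype ι]
    (b : Basis ι K A) (hb : ∀ i j, i ≠ j → Algebra.trace K A (b i * b j) = 0) :
    (traceQuadraticForm K A).signature =
      ∑ i, (SignType.sign (Algebra.trace K A (b i * b i)) : ℤ) := by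
  have : Invertible (2 : K) := invertibleOfNonzero two_ne_zero
  rw [← signature_weightedSumSquares]
  refine signature_congr (Q := traceQuadraticForm K A) (Q' := QuadraticMap.weightedSumSquares K
    fun i ↦ traceQuadraticForm K A (b i)) ?_
  rw [← QuadraticMap.basisRepr_eq_of_iIsOrtho _ b fun i j hij ↦ ?_]
  · exact ⟨QuadraticMap.isometryEquivBasisRepr _ b⟩
  change QuadraticMap.associated (R := K) (traceQuadraticForm K A) (b i) (b j) = 0
  rw [QuadraticMap.associated_apply]
  simp [mul_add, add_mul, hb i j hij, hb j i hij.symm]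

lemma exists_basis_trace_mul_eq_zero {K : Type*} [Field K] (h2 : (2 : K) ≠ 0)
    (A : Type*) [CommRing A] [Algebra K A] [FiniteDimensional K A] :
    ∃ b : Basis (Fin (finrank K A)) K A,
      ∀ i j, i ≠ j → Algebra.trace K A (b i * b j) = 0 := by
  have : Invertible (2 : K) := invertibleOfNonzero h2
  obtain ⟨b, hb⟩ := LinearMap.BilinForm.exists_orthogonal_basis
    (B := Algebra.traceForm K A) ⟨fun x y ↦ by simp [Algebra.traceForm_apply, mul_comm]⟩
  exact ⟨b, fun i j hij ↦ hb hij⟩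

lemma Algebra.trace_one_tmul {K A M : Type*} [Field K] [CommRing A] [Algebra K A]
    [CommRing M] [Algebra K M] [FiniteDimensional K A] (x : A) :
    Algebra.trace M (TensorProduct K M A) (1 ⊗ₜ x) = algebraMap K M (Algebra.trace K A x) := by
  rw [Algebra.trace_apply, Algebra.trace_apply, ← LinearMap.trace_baseChange]
  congr 1
  ext y
  simp

lemma signature_traceQuadraticForm_baseChange {M A : Type*} [Field M] [LinearOrder M]
    [IsStrictOrderedRing M] [Algebra K M] (hM : StrictMono (algebraMap K M))
    [CommRing A] [Algebra K A] [FiniteDimensional K A] :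
    (traceQuadraticForm M (TensorProduct K M A)).signature =
      (traceQuadraticForm K A).signature := by
  obtain ⟨b, hb⟩ := exists_basis_trace_mul_eq_zero (two_ne_zero (α := K)) A
  rw [signature_traceQuadraticForm_eq_sum b hb,
    signature_traceQuadraticForm_eq_sum (Algebra.TensorProduct.basis M b)]
  · refine Finset.sum_congr rfl fun i _ ↦ ?_
    rw [Algebra.TensorProduct.basis_apply, Algebra.TensorProduct.tmul_mul_tmul, one_mul,
      Algebra.trace_one_tmul, hM.sign_comp]
  · intro i j hij
    rw [Algebra.TensorProduct.basis_apply, Algebra.TensorProduct.basis_apply,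
      Algebra.TensorProduct.tmul_mul_tmul, one_mul, Algebra.trace_one_tmul, hb i j hij, map_zero]

lemma signature_traceQuadraticForm_of_finrank_eq_one {A : Type*} [CommRing A] [Nontrivial A]
    [Algebra K A] (h : finrank K A = 1) : (traceQuadraticForm K A).signature = 1 := by
  have : FiniteDimensional K A := .of_finrank_pos (by omega)
  let b := FiniteDimensional.basisSingleton Unit h (1 : A) one_ne_zero
  have ht : Algebra.trace K A 1 = 1 := by
    rw [← map_one (algebraMap K A), Algebra.trace_algebraMap, h, one_smul]
  rw [signature_traceQuadraticForm_eq_sum b fun i j hij ↦ (hij rfl).elim]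
  simp [b, ht]

end TraceSignature

namespace IsOrderingCone

variable {K : Type*} [Field K] {P : Set K}

lemma mul_self_mem (hP : IsOrderingCone K P) (x : K) : x * x ∈ P := by
  rcases hP.2.2.1 x with h | h
  · exact hP.2.1 x h x h
  · simpa using hP.2.1 _ h _ h

lemma one_mem (hP : IsOrderingCone K P) : (1 : K) ∈ P := by
  simpa using hP.mul_self_mem 1

lemma zero_mem (hP : IsOrderingCone K P) : (0 : K) ∈ P := by
  simpa using hP.mul_self_mem 0

lemma eq_zero_of_mem_of_neg_mem (hP : IsOrderingCone K P) {x : K} (h : x ∈ P) (h' : -x ∈ P) :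
    x = 0 := by
  by_contra hx
  apply hP.2.2.2
  have := hP.2.1 _ (hP.2.1 _ h _ h') _ (hP.mul_self_mem x⁻¹)
  rwa [show x * -x * (x⁻¹ * x⁻¹) = -1 by field_simp] at this

/-- An ordering cone is the set of nonnegative elements of a linear order. -/
lemma exists_linearOrder (hP : IsOrderingCone K P) :
    ∃ (_ : LinearOrder K) (_ : IsStrictOrderedRing K), ∀ x : K, 0 ≤ x ↔ x ∈ P := by
  classical
  let o : LinearOrder K :=
    { le := fun x y ↦ y - x ∈ P
      le_refl := fun x ↦ by simpa using hP.zero_mem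
      le_trans := fun x y z h h' ↦ by simpa using hP.1 _ h _ h'
      le_antisymm := fun x y h h' ↦
        (sub_eq_zero.mp (hP.eq_zero_of_mem_of_neg_mem h (by simpa using h'))).symm
      le_total := fun x y ↦ by simpa using hP.2.2.1 (y - x)
      toDecidableLE := Classical.decRel _ }
  have hle : ∀ x y : K, x ≤ y ↔ y - x ∈ P := fun _ _ ↦ Iff.rfl
  have : IsOrderedAddMonoid K := { add_le_add_left := fun x y h z ↦ by simpa [hle] using h }
  have : ZeroLEOneClass K := ⟨by simpa [hle] using hP.one_mem⟩
  refine ⟨o, .of_mul_pos fun x y hx hy ↦ ?_, fun x ↦ by simp [hle]⟩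
  refine lt_of_le_of_ne ?_ (mul_ne_zero hx.ne' hy.ne').symm
  have hx := hx.le
  have hy := hy.le
  rw [hle, sub_zero] at hx hy ⊢
  exact hP.2.1 _ hx _ hy

lemma of_linearOrder [LinearOrder K] [IsStrictOrderedRing K] :
    IsOrderingCone K {x : K | 0 ≤ x} :=
  ⟨fun _ hx _ hy ↦ add_nonneg hx hy, fun _ hx _ hy ↦ mul_nonneg hx hy,
    fun x ↦ by simpa using le_total 0 x, by simp⟩

/-- A subsemiring containing all squares but not `-1` is contained in an ordering cone. -/
lemma exists_of_subsemiring (T : Subsemiring K) (hT : ∀ x, x * x ∈ T) (h1 : (-1 : K) ∉ T) :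
    ∃ Q : Set K, IsOrderingCone K Q ∧ (T : Set K) ⊆ Q := by
  obtain ⟨S, hTS, hS⟩ := zorn_le_nonempty₀ {S : Subsemiring K | (-1 : K) ∉ S}
    (fun c hc hchain S hSc ↦ ⟨sSup c, by
      change (-1 : K) ∉ sSup c
      rw [Subsemiring.mem_sSup_of_directedOn ⟨S, hSc⟩ hchain.directedOn]
      rintro ⟨s, hs, h⟩
      exact hc hs h, fun _ h ↦ le_sSup h⟩) T h1
  have hsq : ∀ x, x * x ∈ S := fun x ↦ hTS (hT x)
  have key : ∀ a, a ∉ S → ∃ s ∈ S, ∃ t ∈ S, -1 = s + a * t := by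
    intro a ha
    by_contra! hcon
    let S' : Subsemiring K :=
      { carrier := {x | ∃ s ∈ S, ∃ t ∈ S, x = s + a * t}
        zero_mem' := ⟨0, S.zero_mem, 0, S.zero_mem, by simp⟩
        one_mem' := ⟨1, S.one_mem, 0, S.zero_mem, by simp⟩
        add_mem' := by
          rintro _ _ ⟨s, hs, t, ht, rfl⟩ ⟨s', hs', t', ht', rfl⟩
          exact ⟨s + s', S.add_mem hs hs', t + t', S.add_mem ht ht', by ring⟩
        mul_mem' := by
          rintro _ _ ⟨s, hs, t, ht, rfl⟩ ⟨s', hs', t', ht', rfl⟩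
          exact ⟨s * s' + a * a * (t * t'), S.add_mem (S.mul_mem hs hs')
            (S.mul_mem (hsq a) (S.mul_mem ht ht')), s * t' + t * s',
            S.add_mem (S.mul_mem hs ht') (S.mul_mem ht hs'), by ring⟩ }
    have hS' : (-1 : K) ∉ S' := fun ⟨s, hs, t, ht, h⟩ ↦ hcon s hs t ht h
    have hle : S ≤ S' := fun s hs ↦ ⟨s, hs, 0, S.zero_mem, by simp⟩
    exact ha (hS.2 hS' hle ⟨0, S.zero_mem, 1, S.one_mem, by simp⟩)
  refine ⟨S, ⟨fun _ h _ h' ↦ S.add_mem h h', fun _ h _ h' ↦ S.mul_mem h h', fun a ↦ ?_, hS.1⟩, hTS⟩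
  by_contra! ha
  obtain ⟨s, hs, t, ht, h⟩ := key a ha.1
  obtain ⟨s', hs', t', ht', h'⟩ := key (-a) ha.2
  apply hS.1
  have : (-1 : K) = s + s' + s * s' + a * a * (t * t') := by
    linear_combination (1 + s') * h - (a * t) * h'
  rw [this]
  exact S.add_mem (S.add_mem (S.add_mem hs hs') (S.mul_mem hs hs'))
    (S.mul_mem (hsq a) (S.mul_mem ht ht'))

/-- If the ordering cone `P` does not extend to the field `M`, then `-1` is a sum of elements
`p * x ^ 2` of `M` with `p ∈ P`. -/
lemma neg_one_mem_closure (hP : IsOrderingCone K P) {M : Type*} [Field M] [Algebra K M]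
    (h : ¬ ∃ Q : Set M, IsOrderingCone M Q ∧ algebraMap K M '' P ⊆ Q) :
    (-1 : M) ∈ AddSubmonoid.closure {y | ∃ p ∈ P, ∃ x : M, y = algebraMap K M p * (x * x)} := by
  by_contra hcon
  let S : Submonoid M :=
    { carrier := {y | ∃ p ∈ P, ∃ x : M, y = algebraMap K M p * (x * x)}
      one_mem' := ⟨1, hP.one_mem, 1, by simp⟩
      mul_mem' := by
        rintro _ _ ⟨p, hp, x, rfl⟩ ⟨q, hq, y, rfl⟩
        exact ⟨p * q, hP.2.1 _ hp _ hq, x * y, by rw [map_mul]; ring⟩ }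
  have hS : ∀ y ∈ S, y ∈ S.subsemiringClosure := fun y hy ↦ AddSubmonoid.subset_closure hy
  obtain ⟨Q, hQ, hSQ⟩ := exists_of_subsemiring S.subsemiringClosure
    (fun x ↦ hS _ ⟨1, hP.one_mem, x, by simp⟩) hcon
  refine h ⟨Q, hQ, ?_⟩
  rintro _ ⟨p, hp, rfl⟩
  exact hSQ (hS _ ⟨p, hp, 1, by simp⟩)

end IsOrderingCone

/-- For `y` a sum of elements `p * x ^ 2` with `p ∈ P`, there is a similitude of factor `y` of a
diagonal form with coefficients in `P`, one of which is `1`. The matrices `A` and `B` are adjoint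
to each other with respect to this form. -/
lemma exists_similitude_of_mem_closure {K M : Type*} [Field K] [Field M] [Algebra K M] {P : Set K}
    (hP : IsOrderingCone K P) {y : M}
    (hy : y ∈ AddSubmonoid.closure {y | ∃ p ∈ P, ∃ x : M, y = algebraMap K M p * (x * x)}) :
    ∃ (ι : Type) (_ : Fintype ι) (_ : DecidableEq ι) (D : ι → K) (A B : Matrix ι ι M),
      (∀ i, D i ∈ P) ∧ (∃ i, D i = 1) ∧ A * B = y • 1 ∧ B * A = y • 1 ∧
      A.transpose * Matrix.diagonal (fun i ↦ algebraMap K M (D i)) =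
        Matrix.diagonal (fun i ↦ algebraMap K M (D i)) * B := by
  induction hy using AddSubmonoid.closure_induction_right with
  | zero =>
    exact ⟨Unit, inferInstance, inferInstance, fun _ ↦ 1, 0, 0, fun _ ↦ hP.one_mem, ⟨(), rfl⟩,
      by simp⟩
  | add_right y hy z hz ih =>
    obtain ⟨p, hp, x, rfl⟩ := hz
    obtain ⟨ι, _, _, D, A, B, hD, ⟨i, hi⟩, hAB, hBA, hadj⟩ := ih
    refine ⟨ι ⊕ ι, inferInstance, inferInstance, Sum.elim D (p • D),
      Matrix.fromBlocks A ((algebraMap K M p * x) • 1) (-x • 1) B,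
      Matrix.fromBlocks B (-(algebraMap K M p * x) • 1) (x • 1) A, ?_, ⟨.inl i, hi⟩, ?_, ?_, ?_⟩
    · rintro (j | j)
      · exact hD j
      · exact hP.2.1 _ hp _ (hD j)
    · rw [Matrix.fromBlocks_multiply, ← Matrix.fromBlocks_one, Matrix.fromBlocks_smul]
      congr 1
      · rw [hAB]; ext i j; simp; ring
      · ext i j; simp
      · ext i j; simp
      · rw [hBA]; ext i j; simp; ring
    · rw [Matrix.fromBlocks_multiply, ← Matrix.fromBlocks_one, Matrix.fromBlocks_smul]
      congr 1
      · rw [hBA]; ext i j; simp; ring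
      · ext i j; simp
      · ext i j; simp
      · rw [hAB]; ext i j; simp; ring
    · have hdiag : Matrix.diagonal (fun i ↦ algebraMap K M (Sum.elim D (p • D) i)) =
          Matrix.fromBlocks (Matrix.diagonal fun i ↦ algebraMap K M (D i)) 0 0
            (algebraMap K M p • Matrix.diagonal fun i ↦ algebraMap K M (D i)) := by
        rw [← Matrix.diagonal_smul, Matrix.fromBlocks_diagonal]
        congr 1
        ext (i | i) <;> simp [Algebra.smul_def]
      have hadj' : B.transpose * Matrix.diagonal (fun i ↦ algebraMap K M (D i)) =
          Matrix.diagonal (fun i ↦ algebraMap K M (D i)) * A := by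
        have := congrArg Matrix.transpose hadj
        simpa using this.symm
      rw [hdiag, Matrix.fromBlocks_transpose, Matrix.fromBlocks_multiply,
        Matrix.fromBlocks_multiply]
      simp [hadj, hadj', smul_smul, mul_comm, -algebraMap_smul]

/-- If the ordering of `K` does not extend to the finite extension `M`, then the trace form of
`M` has signature zero. -/
lemma signature_traceQuadraticForm_eq_zero {K M : Type*} [Field K] [LinearOrder K]
    [IsStrictOrderedRing K] [Field M] [Algebra K M] [FiniteDimensional K M]
    (h : ¬ ∃ Q : Set M, IsOrderingCone M Q ∧ algebraMap K M '' {x | 0 ≤ x} ⊆ Q) :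
    (traceQuadraticForm K M).signature = 0 := by
  obtain ⟨ι, _, _, D, A, B, hD, ⟨i, hi⟩, hAB, hBA, hadj⟩ :=
    exists_similitude_of_mem_closure .of_linearOrder
      (IsOrderingCone.of_linearOrder.neg_one_mem_closure h)
  let Φ : QuadraticForm K (ι → M) := QuadraticMap.pi fun i ↦ D i • traceQuadraticForm K M
  have hΦ : ∀ v, Φ v = Algebra.trace K M
      (v ⬝ᵥ (Matrix.diagonal fun i ↦ algebraMap K M (D i)).mulVec v) := by
    intro v
    simp only [Φ, QuadraticMap.pi_apply, dotProduct, Matrix.mulVec_diagonal, map_sum,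
      _root_.smul_apply, traceQuadraticForm_apply]
    refine Finset.sum_congr rfl fun i _ ↦ ?_
    rw [← map_smul, Algebra.smul_def, mul_left_comm]
  let e : (ι → M) ≃ₗ[K] (ι → M) := LinearEquiv.ofLinearMap (A.mulVecLin.restrictScalars K)
    ((-B).mulVecLin.restrictScalars K)
    (LinearMap.ext fun v ↦ by
      change A.mulVec ((-B).mulVec v) = v
      rw [Matrix.mulVec_mulVec, Matrix.mul_neg, hAB]
      simp)
    (LinearMap.ext fun v ↦ by
      change (-B).mulVec (A.mulVec v) = v
      rw [Matrix.mulVec_mulVec, Matrix.neg_mul, hBA]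
      simp)
  have hA : ∀ v w, A.mulVec v ⬝ᵥ w = v ⬝ᵥ A.transpose.mulVec w := fun v w ↦ by
    rw [Matrix.dotProduct_mulVec, Matrix.vecMul_transpose]
  have he : Φ.Equivalent (-Φ) := ⟨e, fun v ↦ by
    change -Φ (A.mulVec v) = _
    rw [hΦ, hΦ, hA, Matrix.mulVec_mulVec, Matrix.mulVec_mulVec, hadj, Matrix.mul_assoc, hBA,
      neg_smul, one_smul, Matrix.mul_neg, Matrix.mul_one, Matrix.neg_mulVec, dotProduct_neg,
      map_neg, neg_neg]⟩
  have h0 : QuadraticForm.signature Φ = 0 := by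
    have := QuadraticForm.signature_congr he
    rw [QuadraticForm.signature_neg] at this
    omega
  rw [QuadraticForm.signature_pi, Finset.sum_congr rfl fun i _ ↦ QuadraticForm.signature_smul _ _,
    ← Finset.sum_mul] at h0
  refine (mul_eq_zero.mp h0).resolve_left
    (Finset.sum_pos' (fun j _ ↦ ?_) ⟨i, Finset.mem_univ _, ?_⟩).ne'
  · have : 0 ≤ SignType.sign (D j) := sign_nonneg_iff.mpr (hD j)
    rcases SignType.nonneg_iff.mp this with h | h <;> simp [h]
  · simp [hi]

section Positivity

open Module

universe u w

/-- A finite product of fields which maps to the base field has a factor of degree one. -/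
lemma exists_finrank_eq_one_of_algHom_pi {M I : Type*} [Field M] [Finite I] {L : I → Type*}
    [∀ i, Field (L i)] [∀ i, Algebra M (L i)] (φ : (∀ i, L i) →ₐ[M] M) :
    ∃ i, finrank M (L i) = 1 := by
  classical
  have := Fintype.ofFinite I
  obtain ⟨i, hi⟩ : ∃ i, φ (Pi.single i 1) ≠ 0 := by
    by_contra! h
    have h1 : φ (∑ i, Pi.single i 1) = 1 := by
      rw [Finset.univ_sum_single (fun i ↦ (1 : L i))]
      exact map_one φ
    simp [map_sum, h] at h1
  refine ⟨i, finrank_eq_one_iff'.mpr ⟨1, one_ne_zero, fun x ↦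
    ⟨φ (Pi.single i x) / φ (Pi.single i 1), ?_⟩⟩⟩
  set c := φ (Pi.single i x) / φ (Pi.single i 1) with hc
  by_contra hne
  have hne' : x - c • 1 ≠ 0 := fun h ↦ hne (sub_eq_zero.mp h).symm
  have h0 : φ (Pi.single i (x - c • 1)) = 0 := by
    rw [Pi.single_sub, Pi.single_smul, map_sub, map_smul, hc, smul_eq_mul, div_mul_cancel₀ _ hi,
      sub_self]
  apply hi
  rw [← mul_inv_cancel₀ hne', Pi.single_mul, map_mul, h0, zero_mul]

/-- If the ordering of the finite extension `M` extends that of `K`, then the trace form of `M`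
has positive signature, provided that trace forms of extensions of `M` of smaller degree have
nonnegative signature. -/
lemma signature_traceQuadraticForm_pos_of_forall {K : Type u} {M : Type w} [Field K] [LinearOrder K]
    [IsStrictOrderedRing K] [Field M] [LinearOrder M] [IsStrictOrderedRing M] [Algebra K M]
    [FiniteDimensional K M] (hM : StrictMono (algebraMap K M))
    (ih : ∀ (L : Type w) [Field L] [Algebra M L] [FiniteDimensional M L],
      finrank M L < finrank K M → 0 ≤ (traceQuadraticForm M L).signature) :
    0 < (traceQuadraticForm K M).signature := by
  classical
  rcases eq_or_ne (finrank K M) 1 with h1 | h1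
  · rw [signature_traceQuadraticForm_of_finrank_eq_one h1]
    exact one_pos
  have hpos : 0 < finrank K M := finrank_pos
  have : Algebra.FormallyEtale K M := .of_isSeparable K M
  have : Algebra.FinitePresentation K M :=
    Algebra.FinitePresentation.of_finiteType.mp inferInstance
  have : Algebra.Etale K M := {}
  obtain ⟨I, _, L, _, _, e, hL⟩ :=
    Algebra.Etale.iff_exists_algEquiv_prod M (TensorProduct K M M) |>.mp inferInstance
  have := Fintype.ofFinite I
  have : ∀ i, FiniteDimensional M (L i) := fun i ↦ (hL i).1
  have hsum : ∑ i, finrank M (L i) = finrank K M := by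
    rw [← Module.finrank_pi_fintype, ← e.toLinearEquiv.finrank_eq, Module.finrank_baseChange]
  obtain ⟨j, hj⟩ := exists_finrank_eq_one_of_algHom_pi
    ((Algebra.TensorProduct.lmul'' K (S := M)).comp e.symm.toAlgHom)
  rw [← signature_traceQuadraticForm_baseChange hM, signature_traceQuadraticForm_congr e,
    signature_traceQuadraticForm_pi]
  refine Finset.sum_pos' (fun i _ ↦ ih _ ?_) ⟨j, Finset.mem_univ _, ?_⟩
  · rcases eq_or_ne i j with rfl | hij
    · omega
    · have : finrank M (L i) + finrank M (L j) ≤ finrank K M := by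
        rw [← hsum, ← Finset.sum_pair (f := fun i ↦ finrank M (L i)) hij]
        exact Finset.sum_le_sum_of_subset (Finset.subset_univ _)
      omega
  · rw [signature_traceQuadraticForm_of_finrank_eq_one hj]
    exact one_pos

lemma exists_linearOrder_strictMono_algebraMap {K M : Type*} [Field K] [LinearOrder K]
    [IsStrictOrderedRing K] [Field M] [Algebra K M] {Q : Set M} (hQ : IsOrderingCone M Q)
    (hKQ : algebraMap K M '' {x | 0 ≤ x} ⊆ Q) :
    ∃ (_ : LinearOrder M) (_ : IsStrictOrderedRing M), StrictMono (algebraMap K M) := by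
  obtain ⟨_, _, h⟩ := hQ.exists_linearOrder
  refine ⟨_, ‹_›, Monotone.strictMono_of_injective (fun x y hxy ↦ ?_)
    (algebraMap K M).injective⟩
  rw [← sub_nonneg, ← map_sub, h]
  exact hKQ ⟨_, sub_nonneg.mpr hxy, rfl⟩

lemma signature_traceQuadraticForm_nonneg (K M : Type w) [Field K] [LinearOrder K]
    [IsStrictOrderedRing K] [Field M] [Algebra K M] [FiniteDimensional K M] :
    0 ≤ (traceQuadraticForm K M).signature := by
  induction hn : finrank K M using Nat.strong_induction_on generalizing K M with
  | _ n ih =>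
    by_cases h : ∃ Q : Set M, IsOrderingCone M Q ∧ algebraMap K M '' {x | 0 ≤ x} ⊆ Q
    · obtain ⟨Q, hQ, hKQ⟩ := h
      obtain ⟨_, _, hM⟩ := exists_linearOrder_strictMono_algebraMap hQ hKQ
      exact (signature_traceQuadraticForm_pos_of_forall hM
        fun L _ _ _ hL ↦ ih _ (hn ▸ hL) M L rfl).le
    · exact (signature_traceQuadraticForm_eq_zero h).ge

/-- The ordering of `K` extends to the finite extension `M` if and only if the trace form of `M`
has positive signature. -/
lemma signature_traceQuadraticForm_pos_iff {K : Type u} {M : Type w} [Field K] [LinearOrder K]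
    [IsStrictOrderedRing K] [Field M] [Algebra K M] [FiniteDimensional K M] :
    0 < (traceQuadraticForm K M).signature ↔
      ∃ Q : Set M, IsOrderingCone M Q ∧ algebraMap K M '' {x | 0 ≤ x} ⊆ Q := by
  constructor
  · intro h
    by_contra hcon
    exact h.ne' (signature_traceQuadraticForm_eq_zero hcon)
  · rintro ⟨Q, hQ, hKQ⟩
    obtain ⟨_, _, hM⟩ := exists_linearOrder_strictMono_algebraMap hQ hKQ
    exact signature_traceQuadraticForm_pos_of_forall hM
      fun L _ _ _ _ ↦ signature_traceQuadraticForm_nonneg M L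

end Positivity

section Harrison

open Module

open scoped Classical in
/-- The sign of `c` with respect to an ordering with cone `P`. -/
noncomputable def coneSign {K : Type*} [Field K] (P : Set K) (c : K) : ℤ :=
  if c = 0 then 0 else if c ∈ P then 1 else -1

lemma IsOrderingCone.exists_extension_iff {K M ι : Type*} [Field K] [Field M] [Algebra K M]
    [Fintype ι] {P : Set K} (hP : IsOrderingCone K P) (b : Basis ι K M)
    (hb : ∀ i j, i ≠ j → Algebra.trace K M (b i * b j) = 0) :
    (∃ Q : Set M, IsOrderingCone M Q ∧ algebraMap K M '' P ⊆ Q) ↔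
      0 < ∑ i, coneSign P (Algebra.trace K M (b i * b i)) := by
  obtain ⟨_, _, h⟩ := hP.exists_linearOrder
  have : FiniteDimensional K M := b.finiteDimensional_of_finite
  have hsign : ∀ c, coneSign P c = SignType.sign c := by
    intro c
    rw [coneSign, ← h c]
    rcases lt_trichotomy c 0 with hc | hc | hc
    · simp [hc, hc.ne, hc.not_ge]
    · simp [hc]
    · simp [hc, hc.ne', hc.le]
  obtain rfl : P = {x | 0 ≤ x} := Set.ext fun x ↦ (h x).symm
  rw [← signature_traceQuadraticForm_pos_iff, signature_traceQuadraticForm_eq_sum b hb]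
  simp_rw [hsign]

attribute [local instance] harrisonTopology

lemma isClopen_setOf_mem {K : Type*} [Field K] {c : K} (hc : c ≠ 0) :
    IsClopen {P : {P : Set K // IsOrderingCone K P} | c ∈ P.1} := by
  have hopen : ∀ c : K, c ≠ 0 → IsOpen {P : {P : Set K // IsOrderingCone K P} | c ∈ P.1} :=
    fun c hc ↦ .basic _ ⟨c, hc, rfl⟩
  refine ⟨⟨?_⟩, hopen c hc⟩
  convert hopen (-c) (neg_ne_zero.mpr hc) using 1
  ext P
  exact ⟨fun h ↦ (P.2.2.2.1 c).resolve_left h,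
    fun h h' ↦ hc (P.2.eq_zero_of_mem_of_neg_mem h' h)⟩

lemma continuous_coneSign {K : Type*} [Field K] (c : K) :
    Continuous fun P : {P : Set K // IsOrderingCone K P} ↦ coneSign P.1 c := by
  classical
  rcases eq_or_ne c 0 with rfl | hc
  · simpa only [coneSign, if_true] using continuous_const
  · simp only [coneSign, hc, if_false]
    refine Continuous.if (fun P hP ↦ ?_) continuous_const continuous_const
    rw [(isClopen_setOf_mem hc).frontier_eq] at hP
    exact hP.elim

/-- The set of orderings which extend to a given finite extension is clopen. -/
theorem isClopen_setOf_exists_extension (K M : Type*) [Field K] [Field M] [Algebra K M]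
    [FiniteDimensional K M] :
    IsClopen {P : {P : Set K // IsOrderingCone K P} |
      ∃ Q : Set M, IsOrderingCone M Q ∧ algebraMap K M '' P.1 ⊆ Q} := by
  rcases isEmpty_or_nonempty {P : Set K // IsOrderingCone K P} with _ | ⟨⟨P, hP⟩⟩
  · rw [Set.eq_empty_of_isEmpty {P : {P : Set K // IsOrderingCone K P} | _}]
    exact isClopen_empty
  have h2 : (2 : K) ≠ 0 := by
    obtain ⟨_, _, -⟩ := hP.exists_linearOrder
    exact two_ne_zero
  obtain ⟨b, hb⟩ := exists_basis_trace_mul_eq_zero h2 M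
  simp_rw [fun P : {P : Set K // IsOrderingCone K P} ↦ P.2.exists_extension_iff b hb]
  exact (isClopen_discrete (Set.Ioi (0 : ℤ))).preimage
    (continuous_finsetSum _ fun i _ ↦ continuous_coneSign _)

end Harrison

/-- Let `K` be a field, `L/K` a finite Galois extension with `L` not
formally real, `F/K` a finite Galois extension and `E ⊆ F` a totally real extension of
`K`.  For every real involution `ε ∈ Gal(F/E)`, the set
`X_ε = {P ∈ X(K) : P extends to F(ε)}` is clopen in the space of orderings `X(K)`. -/
theorem extension_set_clopen
    (K L F : Type*) [Field K] [Field L] [Algebra K L] [IsGalois K L]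
    [FiniteDimensional K L] (hL : ¬ IsFormallyRealField L)
    [Field F] [Algebra K F] [IsGalois K F] [FiniteDimensional K F]
    (E : IntermediateField K F)
    (hE : ∀ P : Set K, IsOrderingCone K P →
      ∃ Q : Set ↥E, IsOrderingCone ↥E Q ∧ (algebraMap K ↥E) '' P ⊆ Q)
    (ε : F ≃ₐ[K] F) (hε : orderOf ε = 2) (hεE : ε ∈ E.fixingSubgroup)
    (hreal : IsFormallyRealField ↥(fixedField (Subgroup.zpowers ε))) :
    @IsClopen _ (harrisonTopology K)
      {P : {P : Set K // IsOrderingCone K P} |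
        ∃ Q : Set ↥(fixedField (Subgroup.zpowers ε)),
          IsOrderingCone ↥(fixedField (Subgroup.zpowers ε)) Q ∧
          (algebraMap K ↥(fixedField (Subgroup.zpowers ε))) '' P.1 ⊆ Q} := by
  exact isClopen_setOf_exists_extension K _
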